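/- arXiv:1403.2543 — 2 statements merged into one kernel-verified Lean document; each statement's English description precedes it below -/
import Mathlib

section
/- Let ρ_AB = ∑_{i∈I} λ_i σ_i ⊗ ω_i be a separable state on ℂ^{d_A} ⊗ ℂ^{d_B}, where (λ_i)_{i∈I} is a finite probability distribution, each σ_i is a state on ℂ^{d_A} and each ω_i is a state on ℂ^{d_B}; let ρ_A = Tr_B ρ_AB = ∑_i λ_i σ_i. Then for every natural number k with 1 ≤ k ≤ d_A and every orthogonal projection Q on ℂ^{d_A} ⊗ ℂ^{d_B} with Tr Q = k, there exists an orthogonal projection P on ℂ^{d_A} with Tr P = k such that Tr(P ρ_A) ≥ Tr(Q ρ_AB); equivalently, max{Tr(P ρ_A) : P an orthogonal projection on ℂ^{d_A} with Tr P = k} ≥ max{Tr(Q ρ_AB) : Q an orthogonal projection on ℂ^{d_A}⊗ℂ^{d_B} with Tr Q = k}. -/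
open Matrix
open scoped ComplexOrder Kronecker

noncomputable section

/-- A quantum effect: a matrix `M` with `0 ≤ M ≤ 1` in the Loewner order. -/
def IsEffect {n : Type*} [DecidableEq n] (M : Matrix n n ℂ) : Prop :=
  M.PosSemidef ∧ (1 - M).PosSemidef

section

variable {m n ι : Type*} [Fintype m] [DecidableEq m] [Fintype n] [DecidableEq n]

theorem exists_unitary_diagonalization {A : Matrix n n ℂ} (hA : A.PosSemidef) :
    ∃ (U : Matrix n n ℂ) (d : n → ℝ), (∀ a, 0 ≤ d a) ∧ Uᴴ * U = 1 ∧ U * Uᴴ = 1 ∧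
      A = U * diagonal (fun a => (d a : ℂ)) * Uᴴ := by
  refine ⟨hA.1.eigenvectorUnitary, hA.1.eigenvalues, hA.eigenvalues_nonneg,
    Unitary.coe_star_mul_self _, Unitary.coe_mul_star_self _, ?_⟩
  conv_lhs => rw [hA.1.spectral_theorem, Unitary.conjStarAlgAut_apply]
  rfl

theorem unitary_conj_diagonal_mul {U : Matrix n n ℂ} (hU : Uᴴ * U = 1) (f g : n → ℂ) :
    (U * diagonal f * Uᴴ) * (U * diagonal g * Uᴴ) = U * diagonal (fun a => f a * g a) * Uᴴ := by
  rw [← diagonal_mul_diagonal]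
  calc _ = U * diagonal f * (Uᴴ * U) * diagonal g * Uᴴ := by simp only [Matrix.mul_assoc]
    _ = _ := by rw [hU]; simp only [Matrix.mul_assoc, Matrix.mul_one]

theorem conjTranspose_unitary_conj_diagonal (U : Matrix n n ℂ) (f : n → ℝ) :
    (U * diagonal (fun a => (f a : ℂ)) * Uᴴ)ᴴ = U * diagonal (fun a => (f a : ℂ)) * Uᴴ := by
  simp only [conjTranspose_mul, conjTranspose_conjTranspose, diagonal_conjTranspose,
    Matrix.mul_assoc]
  congr 3
  ext a
  simp

theorem isEffect_of_isHermitian_of_mul_self {P : Matrix n n ℂ} (h : P.IsHermitian)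
    (h2 : P * P = P) : IsEffect P := by
  have key {R : Matrix n n ℂ} (h : R.IsHermitian) (h2 : R * R = R) : R.PosSemidef := by
    have := posSemidef_conjTranspose_mul_self R
    rwa [h.eq, h2] at this
  refine ⟨key h h2, key (isHermitian_one.sub h) ?_⟩
  simp [Matrix.sub_mul, Matrix.mul_sub, h2]

theorem IsEffect.conj {M : Matrix m m ℂ} (hM : IsEffect M) {C : Matrix m n ℂ}
    (hC : IsEffect (Cᴴ * C)) : IsEffect (Cᴴ * M * C) := by
  refine ⟨hM.1.conjTranspose_mul_mul_same C, ?_⟩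
  have := hC.2.add (hM.2.conjTranspose_mul_mul_same C)
  rwa [Matrix.mul_sub, Matrix.sub_mul, Matrix.mul_one, sub_add_sub_cancel] at this

theorem trace_mul_re_nonneg {A B : Matrix n n ℂ} (hA : A.PosSemidef) (hB : B.PosSemidef) :
    0 ≤ (A * B).trace.re := by
  obtain ⟨U, d, hd, -, -, rfl⟩ := exists_unitary_diagonalization hB
  rw [← Matrix.mul_assoc, trace_mul_comm, ← Matrix.mul_assoc, ← Matrix.mul_assoc]
  have h := hA.conjTranspose_mul_mul_same U
  simp only [trace, diag_apply, mul_diagonal, Complex.re_sum, Complex.re_mul_ofReal]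
  exact Finset.sum_nonneg fun a _ =>
    mul_nonneg (Complex.le_def.1 h.diag_nonneg).1 (hd a)

/-- A partial isometry `C` from the polar decomposition of `X`. -/
theorem exists_partialIsometry (X : Matrix m n ℂ) :
    ∃ C : Matrix m n ℂ, IsEffect (Cᴴ * C) ∧ IsEffect (C * Cᴴ) ∧ C * (Xᴴ * X) * Cᴴ = X * Xᴴ := by
  obtain ⟨U, d, hd, hU, hU', hX⟩ :=
    exists_unitary_diagonalization (posSemidef_conjTranspose_mul_self X)
  set s : n → ℝ := fun a => (√(d a))⁻¹ with hs
  have hsd (a : n) : s a * d a * s a = if d a = 0 then 0 else 1 := by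
    split_ifs with h
    · simp [h]
    · have h1 : √(d a) ≠ 0 := (Real.sqrt_ne_zero (hd a)).2 h
      simp only [hs]
      field_simp
      exact (Real.sq_sqrt (hd a)).symm
  set e : n → ℝ := fun a => if d a = 0 then 0 else 1 with he
  set S : Matrix n n ℂ := U * diagonal (fun a => (s a : ℂ)) * Uᴴ with hS
  set E : Matrix n n ℂ := U * diagonal (fun a => (e a : ℂ)) * Uᴴ with hE
  have hSH : Sᴴ = S := conjTranspose_unitary_conj_diagonal U s
  have hEH : Eᴴ = E := conjTranspose_unitary_conj_diagonal U e
  have hSXS : S * (Xᴴ * X) * S = E := by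
    rw [hX, unitary_conj_diagonal_mul hU, unitary_conj_diagonal_mul hU]
    simp_rw [← Complex.ofReal_mul, hsd, hE, he]
  have hEE : E * E = E := by
    rw [hE, unitary_conj_diagonal_mul hU]
    congr 3
    ext a
    simp only [he]
    split_ifs <;> simp
  have hSE : S * E = S := by
    rw [hE, hS, unitary_conj_diagonal_mul hU]
    congr 3
    ext a
    by_cases h : d a = 0 <;> simp [he, hs, h]
  have hXSS : (Xᴴ * X) * E = Xᴴ * X := by
    rw [hX, hE, unitary_conj_diagonal_mul hU]
    congr 3
    ext a
    by_cases h : d a = 0 <;> simp [he, h]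
  have hXE : X * E = X := by
    have : (X * (1 - E))ᴴ * (X * (1 - E)) = 0 := by
      rw [conjTranspose_mul, Matrix.mul_assoc, ← Matrix.mul_assoc Xᴴ, Matrix.mul_sub (Xᴴ * X),
        hXSS]
      simp
    rw [conjTranspose_mul_self_eq_zero, Matrix.mul_sub, Matrix.mul_one, sub_eq_zero] at this
    exact this.symm
  have hCC : (X * S)ᴴ * (X * S) = E := by
    rw [conjTranspose_mul, hSH, ← hSXS]
    simp only [Matrix.mul_assoc]
  refine ⟨X * S, ?_, ?_, ?_⟩
  · rw [hCC]
    exact isEffect_of_isHermitian_of_mul_self hEH hEE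
  · refine isEffect_of_isHermitian_of_mul_self (isHermitian_mul_conjTranspose_self _) ?_
    rw [Matrix.mul_assoc, ← Matrix.mul_assoc (X * S)ᴴ, hCC, ← Matrix.mul_assoc,
      Matrix.mul_assoc X, hSE]
  · rw [conjTranspose_mul, hSH]
    calc _ = X * (S * (Xᴴ * X) * S) * Xᴴ := by simp only [Matrix.mul_assoc]
      _ = _ := by rw [hSXS, hXE]

/-- An effect paired with `X Xᴴ` can be moved to an effect paired with `Xᴴ X`. -/
theorem IsEffect.exists_transfer {M : Matrix m m ℂ} (hM : IsEffect M) (X : Matrix m n ℂ) :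
    ∃ M' : Matrix n n ℂ, IsEffect M' ∧ M'.trace.re ≤ M.trace.re ∧
      (M * (X * Xᴴ)).trace = (M' * (Xᴴ * X)).trace := by
  obtain ⟨C, hC, hC', hX⟩ := exists_partialIsometry X
  refine ⟨Cᴴ * M * C, hM.conj hC, ?_, ?_⟩
  · have := trace_mul_re_nonneg hM.1 hC'.2
    rw [Matrix.mul_sub, Matrix.mul_one, trace_sub, Complex.sub_re] at this
    rw [Matrix.mul_assoc, trace_mul_comm, Matrix.mul_assoc]
    linarith
  · rw [← hX, ← Matrix.mul_assoc, trace_mul_comm]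
    simp only [Matrix.mul_assoc]

theorem IsEffect.hadamard {M W : Matrix n n ℂ} (hM : IsEffect M) (hW : W.PosSemidef)
    (hW1 : ∀ i, W i i = 1) : IsEffect (M ⊙ W) := by
  refine ⟨hM.1.hadamard hW, ?_⟩
  have := hM.2.hadamard hW
  have h1 : (1 - M) ⊙ W = 1 - M ⊙ W := by
    ext i j
    rcases eq_or_ne i j with rfl | h
    · simp [hadamard_apply, hW1]
    · simp [hadamard_apply, h]
  rwa [h1] at this

theorem exists_finset_card_eq_forall_le [Fintype ι] [DecidableEq ι] (d : ι → ℝ) {k : ℕ}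
    (hk : k ≤ Fintype.card ι) :
    ∃ S : Finset ι, S.card = k ∧ ∀ a ∈ S, ∀ b ∉ S, d b ≤ d a := by
  induction k with
  | zero => exact ⟨∅, by simp⟩
  | succ k ih =>
    obtain ⟨S, hS, h⟩ := ih (by omega)
    have hne : Sᶜ.Nonempty := by
      rw [← Finset.card_pos, Finset.card_compl]
      omega
    obtain ⟨c, hc, hmax⟩ := Finset.exists_max_image Sᶜ d hne
    rw [Finset.mem_compl] at hc
    refine ⟨insert c S, by rw [Finset.card_insert_of_notMem hc, hS], fun a ha b hb => ?_⟩
    rw [Finset.mem_insert, not_or] at hb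
    rcases Finset.mem_insert.1 ha with rfl | ha
    · exact hmax b (Finset.mem_compl.2 hb.2)
    · exact h a ha b hb.2

theorem exists_finset_sum_mul_le [Fintype ι] [DecidableEq ι] {d w : ι → ℝ}
    (hd : ∀ a, 0 ≤ d a) (hw0 : ∀ a, 0 ≤ w a) (hw1 : ∀ a, w a ≤ 1) {k : ℕ} (hk : k ≤ Fintype.card ι)
    (hw : ∑ a, w a ≤ k) :
    ∃ S : Finset ι, S.card = k ∧ ∑ a, w a * d a ≤ ∑ a ∈ S, d a := by
  obtain ⟨S, hS, h⟩ := exists_finset_card_eq_forall_le d hk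
  refine ⟨S, hS, ?_⟩
  obtain ⟨t, ht0, ht, ht'⟩ : ∃ t : ℝ, 0 ≤ t ∧ (∀ a ∈ S, t ≤ d a) ∧ ∀ b ∉ S, w b * d b ≤ w b * t := by
    rcases S.eq_empty_or_nonempty with rfl | hne
    · have hw' : ∑ a, w a ≤ 0 := by simpa [← hS] using hw
      refine ⟨0, le_rfl, by simp, fun b _ => ?_⟩
      have : w b ≤ 0 := (Finset.single_le_sum (fun a _ => hw0 a) (Finset.mem_univ b)).trans hw'
      simp [le_antisymm this (hw0 b)]
    · obtain ⟨c, hc, hmin⟩ := Finset.exists_min_image S d hne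
      exact ⟨d c, hd c, hmin, fun b hb => mul_le_mul_of_nonneg_left (h c hc b hb) (hw0 b)⟩
  have key (a : ι) : w a * d a ≤ w a * t + if a ∈ S then d a - t else 0 := by
    split_ifs with ha
    · nlinarith [ht a ha, hw1 a]
    · simpa using ht' a ha
  calc ∑ a, w a * d a ≤ ∑ a, (w a * t + if a ∈ S then d a - t else 0) :=
        Finset.sum_le_sum fun a _ => key a
    _ = (∑ a, w a) * t + (∑ a ∈ S, d a - k * t) := by
        simp [Finset.sum_add_distrib, Finset.sum_mul, ← hS]
    _ ≤ ∑ a ∈ S, d a := by nlinarith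

/-- Ky Fan's maximum principle: effects of trace at most `k` are dominated by rank-`k` orthogonal
projections. -/
theorem IsEffect.exists_projection {M ρ : Matrix n n ℂ} (hM : IsEffect M) (hρ : ρ.PosSemidef)
    {k : ℕ} (hk : k ≤ Fintype.card n) (hMk : M.trace.re ≤ k) :
    ∃ P : Matrix n n ℂ, P.IsHermitian ∧ P * P = P ∧ P.trace = (k : ℂ) ∧
      (M * ρ).trace.re ≤ (P * ρ).trace.re := by
  obtain ⟨U, d, hd, hU, hU', rfl⟩ := exists_unitary_diagonalization hρ
  have hN : IsEffect (Uᴴ * M * U) :=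
    hM.conj (by rw [hU]; exact ⟨PosSemidef.one, by simpa using PosSemidef.zero⟩)
  obtain ⟨S, hS, hle⟩ := exists_finset_sum_mul_le (w := fun a => ((Uᴴ * M * U) a a).re) hd
    (fun a => (Complex.le_def.1 hN.1.diag_nonneg).1)
    (fun a => by simpa using (Complex.le_def.1 (hN.2.diag_nonneg (i := a))).1) hk (by
      rw [← Complex.re_sum]
      change (Uᴴ * M * U).trace.re ≤ k
      rwa [Matrix.mul_assoc, trace_mul_comm, Matrix.mul_assoc, hU', Matrix.mul_one])
  set e : n → ℝ := fun a => if a ∈ S then 1 else 0 with he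
  have htr (f : n → ℂ) : (U * diagonal f * Uᴴ).trace = ∑ a, f a := by
    rw [trace_mul_comm, ← Matrix.mul_assoc, hU, Matrix.one_mul, trace_diagonal]
  refine ⟨U * diagonal (fun a => (e a : ℂ)) * Uᴴ, conjTranspose_unitary_conj_diagonal U e,
    ?_, ?_, ?_⟩
  · rw [unitary_conj_diagonal_mul hU]
    congr 3
    ext a
    simp only [he]
    split_ifs <;> simp
  · rw [htr, ← Complex.ofReal_sum]
    simp [he, hS]
  · rw [unitary_conj_diagonal_mul hU, htr, ← Matrix.mul_assoc, trace_mul_comm,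
      ← Matrix.mul_assoc, ← Matrix.mul_assoc]
    simp only [trace, diag_apply, mul_diagonal, Complex.re_sum, Complex.re_mul_ofReal,
      Complex.ofReal_re]
    simpa [he] using hle

/-- A separable state is `X Xᴴ` where the columns of `X` are products `v ⊗ w` with `w` a unit
vector; its marginal is then `V Vᴴ`. -/
theorem exists_product_vector_decomposition [Fintype ι]
    {lam : ι → ℝ} (hlam : ∀ i, 0 ≤ lam i)
    {σ : ι → Matrix m m ℂ} (hσ : ∀ i, (σ i).PosSemidef)
    {ω : ι → Matrix n n ℂ} (hω : ∀ i, (ω i).PosSemidef ∧ (ω i).trace = 1) :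
    ∃ (V : Matrix m (ι × m × n) ℂ) (W : Matrix n (ι × m × n) ℂ),
      (∀ j, (Wᴴ * W) j j = 1) ∧ ∑ i, lam i • σ i = V * Vᴴ ∧
      ∑ i, lam i • (σ i ⊗ₖ ω i) =
        (of fun p j => V p.1 j * W p.2 j) * (of fun p j => V p.1 j * W p.2 j)ᴴ := by
  choose U s hs hU hU' hσU using fun i => exists_unitary_diagonalization (hσ i)
  choose T t ht hT hT' hωT using fun i => exists_unitary_diagonalization (hω i).1
  have htsum (i : ι) : ∑ q, (t i q : ℂ) = 1 := by
    rw [← (hω i).2, hωT i, trace_mul_comm, ← Matrix.mul_assoc, hT, Matrix.one_mul, trace_diagonal]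
  have hσe (i : ι) (a a' : m) : σ i a a' = ∑ p, U i a p * s i p * star (U i a' p) := by
    rw [hσU i, mul_apply]
    simp only [mul_diagonal, conjTranspose_apply]
  have hωe (i : ι) (b b' : n) : ω i b b' = ∑ q, T i b q * t i q * star (T i b' q) := by
    rw [hωT i, mul_apply]
    simp only [mul_diagonal, conjTranspose_apply]
  have hsq (i : ι) (p : m) (q : n) :
      (√(lam i * s i p * t i q) : ℂ) * √(lam i * s i p * t i q) = lam i * s i p * t i q := by
    rw [← Complex.ofReal_mul, Real.mul_self_sqrt
      (mul_nonneg (mul_nonneg (hlam i) (hs i p)) (ht i q))]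
    push_cast
    rfl
  refine ⟨of fun a j => √(lam j.1 * s j.1 j.2.1 * t j.1 j.2.2) * U j.1 a j.2.1,
    of fun b j => T j.1 b j.2.2, fun j => ?_, ?_, ?_⟩
  · simpa [mul_apply] using congrFun (congrFun (hT j.1) j.2.2) j.2.2
  · ext a a'
    simp only [Matrix.sum_apply, Matrix.smul_apply, Complex.real_smul, hσe, mul_apply, conjTranspose_apply,
      of_apply, Fintype.sum_prod_type, star_mul', Complex.star_def, Complex.conj_ofReal]
    refine Finset.sum_congr rfl fun i _ => ?_
    rw [Finset.mul_sum]
    refine Finset.sum_congr rfl fun p _ => ?_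
    rw [← mul_one (_ * _), ← htsum i, Finset.mul_sum]
    refine Finset.sum_congr rfl fun q _ => ?_
    linear_combination -(U i a p * (starRingEnd ℂ) (U i a' p)) * hsq i p q
  · ext ⟨a, b⟩ ⟨a', b'⟩
    simp only [Matrix.sum_apply, Matrix.smul_apply, Complex.real_smul, kroneckerMap_apply, hσe, hωe, mul_apply,
      conjTranspose_apply, of_apply, Fintype.sum_prod_type, star_mul', Complex.star_def,
      Complex.conj_ofReal]
    refine Finset.sum_congr rfl fun i _ => ?_
    rw [Finset.sum_mul_sum, Finset.mul_sum]
    refine Finset.sum_congr rfl fun p _ => ?_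
    rw [Finset.mul_sum]
    refine Finset.sum_congr rfl fun q _ => ?_
    linear_combination -(U i a p * (starRingEnd ℂ) (U i a' p) * T i b q *
      (starRingEnd ℂ) (T i b' q)) * hsq i p q

end

/-- For a separable state `ρ_AB = ∑ᵢ λᵢ σᵢ ⊗ ωᵢ` with marginal `ρ_A = ∑ᵢ λᵢ σᵢ`, and for every
orthogonal projection `Q` on the bipartite space with `Tr Q = k` (`1 ≤ k ≤ d_A`), there is an
orthogonal projection `P` on the `A` system with `Tr P = k` and `Tr(Q ρ_AB) ≤ Tr(P ρ_A)`. -/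
theorem separable_proj_bound {dA dB : ℕ} {I : Type} [Fintype I]
    (lam : I → ℝ) (hlam : ∀ i, 0 ≤ lam i) (hlamsum : ∑ i, lam i = 1)
    (σ : I → Matrix (Fin dA) (Fin dA) ℂ)
    (hσ : ∀ i, (σ i).PosSemidef ∧ (σ i).trace = 1)
    (ω : I → Matrix (Fin dB) (Fin dB) ℂ)
    (hω : ∀ i, (ω i).PosSemidef ∧ (ω i).trace = 1)
    (k : ℕ) (hk1 : 1 ≤ k) (hkd : k ≤ dA)
    (Q : Matrix (Fin dA × Fin dB) (Fin dA × Fin dB) ℂ)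
    (hQ : Q.IsHermitian) (hQ2 : Q * Q = Q) (hQtr : Q.trace = (k : ℂ)) :
    ∃ P : Matrix (Fin dA) (Fin dA) ℂ, P.IsHermitian ∧ P * P = P ∧ P.trace = (k : ℂ) ∧
      (Q * ∑ i, lam i • (σ i ⊗ₖ ω i)).trace.re ≤ (P * ∑ i, lam i • σ i).trace.re := by
  classical
  obtain ⟨V, W, hW, hA, hAB⟩ := exists_product_vector_decomposition hlam (fun i => (hσ i).1) hω
  rw [hA, hAB]
  set X : Matrix (Fin dA × Fin dB) (I × Fin dA × Fin dB) ℂ := of fun p j => V p.1 j * W p.2 j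
    with hX
  have hgram : Xᴴ * X = (Vᴴ * V) ⊙ (Wᴴ * W) := by
    ext j j'
    simp only [hX, mul_apply, conjTranspose_apply, of_apply, hadamard_apply, star_mul',
      Fintype.sum_prod_type, Finset.sum_mul_sum]
    exact Finset.sum_congr rfl fun a _ => Finset.sum_congr rfl fun b _ => by ring
  obtain ⟨M, hM, hMtr, hMX⟩ := (isEffect_of_isHermitian_of_mul_self hQ hQ2).exists_transfer X
  have hM' : IsEffect (M ⊙ (Wᴴ * W)ᵀ) :=
    hM.hadamard (posSemidef_conjTranspose_mul_self W).transpose hW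
  have hM'tr : (M ⊙ (Wᴴ * W)ᵀ).trace = M.trace :=
    Finset.sum_congr rfl fun j _ => by
      rw [diag_apply, hadamard_apply, transpose_apply, hW, mul_one, diag_apply]
  obtain ⟨N, hN, hNtr, hNV⟩ := hM'.exists_transfer Vᴴ
  obtain ⟨P, hP, hP2, hPtr, hle⟩ := hN.exists_projection (posSemidef_self_mul_conjTranspose V)
    (k := k) (by simpa using hkd) (by
      rw [hM'tr] at hNtr
      refine (hNtr.trans hMtr).trans ?_
      simp [hQtr])
  refine ⟨P, hP, hP2, hPtr, le_trans (le_of_eq ?_) hle⟩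
  rw [conjTranspose_conjTranspose] at hNV
  rw [hMX, ← hNV, hgram]
  congr 1
  simp only [trace, diag_apply, mul_apply, hadamard_apply, transpose_apply]
  exact Finset.sum_congr rfl fun j _ => Finset.sum_congr rfl fun j' _ => by ring
end
end

section
/- Upper bound on the ensemble average fidelity of visible compression: let {p_i, ψ_i}_{i∈I} be a finite ensemble of pure states on ℂ^d (each ψ_i a rank-one projector, (p_i) a probability distribution) with average state ρ = ∑_i p_i ψ_i. Let M be a natural number with 1 ≤ M ≤ d, let (χ_i)_{i∈I} be arbitrary states on ℂ^M, and let 𝔇 be a CPTP map in Kraus form from M×M matrices to d×d matrices. Then ∑_{i∈I} p_i Tr(𝔇(χ_i) ψ_i) ≤ max{Tr(P ρ) : P an orthogonal projection on ℂ^d with Tr P = M}. -/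
open Matrix
open scoped ComplexOrder

noncomputable section

theorem mul_conjTranspose_apply_self {m n : Type*} [Fintype n] (X : Matrix m n ℂ) (a : m) :
    (X * Xᴴ) a a = ((∑ b, ‖X a b‖ ^ 2 : ℝ) : ℂ) := by
  simp [Matrix.mul_apply, Complex.mul_conj, Complex.normSq_eq_norm_sq]

theorem re_star_dotProduct_self {n : Type*} [Fintype n] (y : n → ℂ) :
    (star y ⬝ᵥ y).re = ∑ i, ‖y i‖ ^ 2 := by
  simp only [dotProduct, Pi.star_apply, RCLike.star_def, Complex.re_sum]
  refine Finset.sum_congr rfl fun i _ => ?_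
  rw [mul_comm, Complex.mul_conj, Complex.normSq_eq_norm_sq, Complex.ofReal_re]

/-- Bessel's inequality for pairwise orthogonal, not necessarily normalised, rows. -/
theorem bessel_of_mul_conjTranspose_eq_diagonal {m n : Type*} [Fintype m] [DecidableEq m]
    [Fintype n] (X : Matrix m n ℂ) (l : m → ℝ)
    (h : X * Xᴴ = diagonal (fun k => (l k : ℂ))) (y : n → ℂ) :
    ∑ k, (l k)⁻¹ * ‖(X *ᵥ y) k‖ ^ 2 ≤ ∑ i, ‖y i‖ ^ 2 := by
  set z : m → ℂ := fun k => ((l k)⁻¹ : ℂ) * (X *ᵥ y) k with hz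
  have h0 : 0 ≤ (star (y - Xᴴ *ᵥ z) ⬝ᵥ (y - Xᴴ *ᵥ z)).re := by
    rw [re_star_dotProduct_self]; positivity
  have e1 : star (Xᴴ *ᵥ z) ⬝ᵥ y = star z ⬝ᵥ (X *ᵥ y) := by
    rw [star_mulVec, conjTranspose_conjTranspose, dotProduct_mulVec]
  have e2 : star y ⬝ᵥ (Xᴴ *ᵥ z) = star (X *ᵥ y) ⬝ᵥ z := by
    rw [star_mulVec, dotProduct_mulVec]
  have e3 : star (Xᴴ *ᵥ z) ⬝ᵥ (Xᴴ *ᵥ z) = star z ⬝ᵥ (diagonal (fun k => (l k : ℂ)) *ᵥ z) := by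
    rw [star_mulVec, conjTranspose_conjTranspose, ← h, ← mulVec_mulVec, dotProduct_mulVec,
      dotProduct_mulVec, dotProduct_mulVec]
  have r1 : (star z ⬝ᵥ (X *ᵥ y)).re = ∑ k, (l k)⁻¹ * ‖(X *ᵥ y) k‖ ^ 2 := by
    simp only [dotProduct, Complex.re_sum]
    refine Finset.sum_congr rfl fun k _ => ?_
    rw [← Complex.normSq_eq_norm_sq, Complex.normSq_apply]
    simp [hz, ← Complex.ofReal_inv]
    ring
  have r2 : (star (X *ᵥ y) ⬝ᵥ z).re = ∑ k, (l k)⁻¹ * ‖(X *ᵥ y) k‖ ^ 2 := by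
    simp only [dotProduct, Complex.re_sum]
    refine Finset.sum_congr rfl fun k _ => ?_
    rw [← Complex.normSq_eq_norm_sq, Complex.normSq_apply]
    simp [hz, ← Complex.ofReal_inv]
    ring
  have r3 : (star z ⬝ᵥ (diagonal (fun k => (l k : ℂ)) *ᵥ z)).re
      = ∑ k, (l k)⁻¹ * ‖(X *ᵥ y) k‖ ^ 2 := by
    simp only [dotProduct, Complex.re_sum, mulVec_diagonal]
    refine Finset.sum_congr rfl fun k _ => ?_
    rw [← Complex.normSq_eq_norm_sq, Complex.normSq_apply]
    have : (l k)⁻¹ * l k * (l k)⁻¹ = (l k)⁻¹ := by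
      by_cases hl : l k = 0
      · simp [hl]
      · field_simp
    simp [hz, ← Complex.ofReal_inv]
    linear_combination (((X *ᵥ y) k).re ^ 2 + ((X *ᵥ y) k).im ^ 2) * this
  rw [star_sub, sub_dotProduct, dotProduct_sub, dotProduct_sub, e1, e2, e3] at h0
  simp only [Complex.sub_re, r1, r2, r3, re_star_dotProduct_self] at h0
  linarith

/-- Left multiplication by a unitary makes the rows of any matrix pairwise orthogonal. -/
theorem exists_unitary_rows_orthogonal {m n : Type*} [Fintype m] [DecidableEq m] [Fintype n]
    (B : Matrix m n ℂ) :
    ∃ (U : Matrix m m ℂ) (l : m → ℝ), U * Uᴴ = 1 ∧ Uᴴ * U = 1 ∧ (∀ k, 0 ≤ l k) ∧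
      (U * B) * (U * B)ᴴ = diagonal (fun k => (l k : ℂ)) := by
  have hB := posSemidef_self_mul_conjTranspose B
  set V : Matrix m m ℂ := hB.isHermitian.eigenvectorUnitary.1
  have h1 : Vᴴ * V = 1 := Unitary.coe_star_mul_self _
  have h2 : V * Vᴴ = 1 := Unitary.coe_mul_star_self _
  refine ⟨Vᴴ, hB.isHermitian.eigenvalues, by simpa using h1, by simpa using h2,
    hB.eigenvalues_nonneg, ?_⟩
  have hs : B * Bᴴ = V * diagonal (fun k => (hB.isHermitian.eigenvalues k : ℂ)) * Vᴴ := by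
    have := hB.isHermitian.spectral_theorem
    rw [Unitary.conjStarAlgAut_apply] at this
    exact this
  calc _ = Vᴴ * (B * Bᴴ) * V := by
        simp only [conjTranspose_mul, conjTranspose_conjTranspose, Matrix.mul_assoc]
    _ = (Vᴴ * V) * diagonal (fun k => (hB.isHermitian.eigenvalues k : ℂ)) *
          (Vᴴ * V) := by
        refine (congrArg (fun Z => Vᴴ * Z * V) hs).trans ?_
        simp only [Matrix.mul_assoc]
    _ = _ := by rw [h1, Matrix.one_mul, Matrix.mul_one]

theorem exists_card_eq_forall_notMem_le {α : Type*} [Fintype α] [DecidableEq α] (f : α → ℝ)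
    (M : ℕ) (hM : M ≤ Fintype.card α) :
    ∃ T : Finset α, T.card = M ∧ ∀ k ∈ T, ∀ l ∉ T, f l ≤ f k := by
  induction M with
  | zero => exact ⟨∅, by simp⟩
  | succ M ih =>
    obtain ⟨T, hT, hTf⟩ := ih (by omega)
    have hne : Tᶜ.Nonempty := by
      rw [← Finset.card_pos, Finset.card_compl]; omega
    obtain ⟨x, hx, hmax⟩ := Finset.exists_max_image Tᶜ f hne
    rw [Finset.mem_compl] at hx
    refine ⟨insert x T, by rw [Finset.card_insert_of_notMem hx, hT], fun k hk l hl => ?_⟩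
    rw [Finset.mem_insert, not_or] at hl
    rcases Finset.mem_insert.1 hk with rfl | hk
    · exact hmax l (Finset.mem_compl.2 hl.2)
    · exact hTf k hk l hl.2

/-- A sum with weights in `[0, 1]` of total mass at most `M` is bounded by the sum of the `M`
largest values. -/
theorem exists_card_eq_sum_mul_le {α : Type*} [Fintype α] [DecidableEq α] (l s : α → ℝ)
    (hl : ∀ k, 0 ≤ l k) (hs0 : ∀ k, 0 ≤ s k) (hs1 : ∀ k, s k ≤ 1) (M : ℕ) (hM1 : 1 ≤ M)
    (hM : M ≤ Fintype.card α) (hs : ∑ k, s k ≤ M) :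
    ∃ T : Finset α, T.card = M ∧ ∑ k, l k * s k ≤ ∑ k ∈ T, l k := by
  obtain ⟨T, hT, hTf⟩ := exists_card_eq_forall_notMem_le l M hM
  refine ⟨T, hT, ?_⟩
  obtain ⟨x, hx, hmin⟩ := Finset.exists_min_image T l (by rw [← Finset.card_pos]; omega)
  have key : ∀ k, l k * s k - (if k ∈ T then l k else 0) ≤
      l x * (s k - if k ∈ T then 1 else 0) := by
    intro k
    by_cases hk : k ∈ T
    · simp only [hk, if_true]
      nlinarith [hmin k hk, hs1 k]
    · simp only [hk, if_false]
      nlinarith [hTf x hx k hk, hs0 k]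
  have := Finset.sum_le_sum fun k (_ : k ∈ Finset.univ) => key k
  rw [← Finset.mul_sum] at this
  simp only [Finset.sum_sub_distrib, Finset.sum_ite_mem, Finset.univ_inter, Finset.sum_const,
    nsmul_eq_mul, mul_one, hT] at this
  nlinarith [hl x]

/-- Vectors `y j` compressed by a Hilbert–Schmidt normalised `C` carry no more weight than some
contractive linear combination of them. -/
theorem exists_combination_ge {J m : Type*} [Fintype J] [Fintype m] [Nonempty m]
    (y : J → m → ℂ) (C : Matrix m m ℂ) (hC : ∑ c, ∑ a, ‖C a c‖ ^ 2 = 1) :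
    ∃ e : J → ℂ, ∑ j, ‖e j‖ ^ 2 ≤ 1 ∧
      ∑ c, ∑ j, ‖(Cᴴ *ᵥ y j) c‖ ^ 2 ≤ ∑ a, ‖∑ j, e j * y j a‖ ^ 2 := by
  have single : ∀ c, ∃ e : J → ℂ, ∑ j, ‖e j‖ ^ 2 ≤ 1 ∧
      ∑ j, ‖(Cᴴ *ᵥ y j) c‖ ^ 2 ≤ (∑ a, ‖C a c‖ ^ 2) * ∑ a, ‖∑ j, e j * y j a‖ ^ 2 := by
    intro c
    set g : J → ℂ := fun j => (Cᴴ *ᵥ y j) c with hg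
    set N : ℝ := ∑ j, ‖g j‖ ^ 2 with hN
    have hN0 : 0 ≤ N := by positivity
    have hsq : √N ^ 2 = N := Real.sq_sqrt hN0
    refine ⟨fun j => ((√N)⁻¹ : ℝ) * star (g j), ?_, ?_⟩
    · simp only [norm_mul, mul_pow, norm_star, ← Finset.mul_sum, ← hN, Complex.norm_real,
        norm_inv, Real.norm_eq_abs, inv_pow, sq_abs, hsq]
      exact inv_mul_le_one
    · set h : m → ℂ := fun a => ∑ j, ((√N)⁻¹ : ℝ) * star (g j) * y j a with hh
      have h1 : ∑ a, star (C a c) * h a = ((√N)⁻¹ * N : ℝ) := by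
        have : ∑ a, star (C a c) * h a = ∑ j, ((√N)⁻¹ : ℝ) * star (g j) * g j := by
          simp only [hh, Finset.mul_sum]
          rw [Finset.sum_comm]
          refine Finset.sum_congr rfl fun j _ => ?_
          simp only [hg, mulVec, dotProduct, conjTranspose_apply, Finset.mul_sum]
          exact Finset.sum_congr rfl fun a _ => by ring
        rw [this, Complex.ofReal_mul, hN, Complex.ofReal_sum, Finset.mul_sum]
        refine Finset.sum_congr rfl fun j _ => ?_
        rw [mul_assoc, mul_comm (star (g j)), RCLike.star_def, Complex.mul_conj,
          Complex.normSq_eq_norm_sq]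
      have h2 : N = ‖∑ a, star (C a c) * h a‖ ^ 2 := by
        rw [h1, Complex.norm_real, Real.norm_eq_abs, sq_abs, mul_pow, inv_pow, hsq]
        by_cases hz : N = 0
        · simp [hz]
        · field_simp
      calc N = ‖∑ a, star (C a c) * h a‖ ^ 2 := h2
        _ ≤ (∑ a, ‖C a c‖ * ‖h a‖) ^ 2 := by
          gcongr
          refine (norm_sum_le _ _).trans (le_of_eq ?_)
          simp
        _ ≤ _ := Finset.sum_mul_sq_le_sq_mul_sq _ _ _
  choose e he1 he2 using single
  obtain ⟨c₀, -, hc₀⟩ := Finset.exists_max_image Finset.univ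
    (fun c => ∑ a, ‖∑ j, e c j * y j a‖ ^ 2) Finset.univ_nonempty
  refine ⟨e c₀, he1 c₀, ?_⟩
  calc _ ≤ ∑ c, (∑ a, ‖C a c‖ ^ 2) * ∑ a, ‖∑ j, e c₀ j * y j a‖ ^ 2 :=
        Finset.sum_le_sum fun c _ => (he2 c).trans
          (mul_le_mul_of_nonneg_left (hc₀ c (Finset.mem_univ c)) (by positivity))
    _ = _ := by rw [← Finset.sum_mul, hC, one_mul]

/-- The Nielsen–Kempe majorisation bound: tensoring the columns of `A` with contractive vectors
`e · i` and compressing with a coisometry `L` onto `M` dimensions captures at most the sum of the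
`M` largest eigenvalues of `A * Aᴴ`. -/
theorem exists_projection_ge_compression {d J N : Type*} [Fintype d] [DecidableEq d] [Fintype J]
    [Fintype N] (A : Matrix d N ℂ) (e : N → J → ℂ) (he : ∀ i, ∑ j, ‖e i j‖ ^ 2 ≤ 1)
    {M : ℕ} (hM1 : 1 ≤ M) (hMd : M ≤ Fintype.card d) (L : Matrix (Fin M) (J × d) ℂ)
    (hL : L * Lᴴ = 1) :
    ∃ P : Matrix d d ℂ, P.IsHermitian ∧ P * P = P ∧ P.trace = (M : ℂ) ∧
      ∑ m, ∑ i, ‖(L * Matrix.of fun (x : J × d) i => e i x.1 * A x.2 i) m i‖ ^ 2 ≤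
        (P * (A * Aᴴ)).trace.re := by
  set E : Matrix (J × d) N ℂ := Matrix.of fun x i => e i x.1 * A x.2 i with hE
  obtain ⟨U, l, hU1, hU2, hl, hUA⟩ := exists_unitary_rows_orthogonal A
  obtain ⟨W, t, hW1, hW2, ht, hWT⟩ := exists_unitary_rows_orthogonal (L * E)
  set B := U * A with hB
  set T := W * (L * E) with hT
  have hBl : ∀ k, ∑ i, ‖B k i‖ ^ 2 = l k := fun k => by
    have := mul_conjTranspose_apply_self B k
    rw [hUA, diagonal_apply_eq] at this
    exact_mod_cast this.symm
  have hTt : ∀ m, ∑ i, ‖T m i‖ ^ 2 = t m := fun m => by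
    have := mul_conjTranspose_apply_self T m
    rw [hWT, diagonal_apply_eq] at this
    exact_mod_cast this.symm
  have hsum : ∑ m, ∑ i, ‖(L * E) m i‖ ^ 2 = ∑ m, t m := by
    have h1 : ((L * E) * (L * E)ᴴ).trace = (T * Tᴴ).trace := by
      rw [hT, conjTranspose_mul W, trace_mul_comm (W * (L * E)), Matrix.mul_assoc _ Wᴴ,
        ← Matrix.mul_assoc Wᴴ, hW2, Matrix.one_mul, trace_mul_comm]
    have h2 := congrArg Complex.re h1
    simpa only [trace, diag_apply, mul_conjTranspose_apply_self, Complex.re_sum,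
      Complex.ofReal_re, hTt] using h2
  set q : J → d → Fin M → ℝ := fun j k m => ‖∑ i, B k i * e i j * star (T m i)‖ ^ 2 with hq
  set x : d → ℝ := fun k => ∑ j, ∑ m, (t m)⁻¹ * q j k m with hx
  have hq0 : ∀ j k m, 0 ≤ q j k m := fun _ _ _ => by positivity
  have hx0 : ∀ k, 0 ≤ x k := fun k => Finset.sum_nonneg fun j _ => Finset.sum_nonneg fun m _ =>
    mul_nonneg (inv_nonneg.2 (ht m)) (hq0 _ _ _)
  have hcol : ∀ m, t m ^ 2 ≤ ∑ j, ∑ k, q j k m := by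
    intro m
    set y : N → ℂ := fun i => star (T m i) with hy
    have hWL : (W * L) * (W * L)ᴴ = diagonal (fun _ => ((1 : ℝ) : ℂ)) := by
      rw [conjTranspose_mul, Matrix.mul_assoc, ← Matrix.mul_assoc L, hL, Matrix.one_mul, hW1]
      simp
    have h1 := bessel_of_mul_conjTranspose_eq_diagonal (W * L) _ hWL (E *ᵥ y)
    have h2 : ((W * L) *ᵥ (E *ᵥ y)) m = (t m : ℂ) := by
      rw [mulVec_mulVec, Matrix.mul_assoc, ← hT]
      have := congrFun (congrFun hWT m) m
      rwa [diagonal_apply_eq] at this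
    have h3 : t m ^ 2 ≤ ∑ z, ‖(E *ᵥ y) z‖ ^ 2 := by
      refine le_trans ?_ h1
      refine le_trans (le_of_eq ?_) (Finset.single_le_sum (fun k _ => by positivity)
        (Finset.mem_univ m))
      rw [h2]; simp
    refine h3.trans ?_
    rw [Fintype.sum_prod_type]
    refine Finset.sum_le_sum fun j _ => ?_
    set u : d → ℂ := A *ᵥ fun i => e i j * y i with hu
    have h4 : ∀ a, (E *ᵥ y) (j, a) = u a := fun a => by
      simp only [hE, hu, mulVec, dotProduct, of_apply]
      exact Finset.sum_congr rfl fun i _ => by ring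
    have h5 : ∀ k, q j k m = ‖(U *ᵥ u) k‖ ^ 2 := fun k => by
      simp only [hq, hu, mulVec_mulVec, ← hB]
      simp only [hy, mulVec, dotProduct, mul_assoc]
    simp only [h4, h5]
    have hUh : Uᴴ * Uᴴᴴ = diagonal (fun _ => ((1 : ℝ) : ℂ)) := by
      rw [conjTranspose_conjTranspose, hU2]; simp
    have h6 := bessel_of_mul_conjTranspose_eq_diagonal Uᴴ _ hUh (U *ᵥ u)
    simpa [mulVec_mulVec, hU2] using h6
  have htx : ∑ m, t m ≤ ∑ k, x k := by
    have h1 : ∑ k, x k = ∑ m, (t m)⁻¹ * ∑ j, ∑ k, q j k m := by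
      simp only [hx, Finset.mul_sum]
      rw [Finset.sum_comm]
      conv_rhs => rw [Finset.sum_comm]
      exact Finset.sum_congr rfl fun j _ => Finset.sum_comm
    rw [h1]
    refine Finset.sum_le_sum fun m _ => ?_
    refine le_trans (le_of_eq ?_) (mul_le_mul_of_nonneg_left (hcol m) (inv_nonneg.2 (ht m)))
    by_cases h : t m = 0
    · simp [h]
    · field_simp
  have hxl : ∀ k, x k ≤ l k := by
    intro k
    calc x k ≤ ∑ j, ∑ i, ‖star (B k i * e i j)‖ ^ 2 := by
          refine Finset.sum_le_sum fun j _ => ?_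
          refine le_trans (le_of_eq ?_)
            (bessel_of_mul_conjTranspose_eq_diagonal T t hWT fun i => star (B k i * e i j))
          refine Finset.sum_congr rfl fun m _ => ?_
          simp only [hq]
          rw [← norm_star (∑ i, _)]
          congr 3
          simp only [mulVec, dotProduct, star_sum, star_mul, star_star]
      _ = ∑ i, ‖B k i‖ ^ 2 * ∑ j, ‖e i j‖ ^ 2 := by
          rw [Finset.sum_comm]
          simp only [norm_star, norm_mul, mul_pow, Finset.mul_sum]
      _ ≤ ∑ i, ‖B k i‖ ^ 2 := Finset.sum_le_sum fun i _ =>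
          mul_le_of_le_one_right (by positivity) (he i)
      _ = l k := hBl k
  have hxM : ∑ k, (l k)⁻¹ * x k ≤ M := by
    calc ∑ k, (l k)⁻¹ * x k = ∑ m, (t m)⁻¹ * ∑ j, ∑ k, (l k)⁻¹ * q j k m := by
          simp only [hx, Finset.mul_sum]
          rw [Finset.sum_comm]
          conv_rhs => rw [Finset.sum_comm]
          refine Finset.sum_congr rfl fun j _ => ?_
          rw [Finset.sum_comm]
          exact Finset.sum_congr rfl fun m _ => Finset.sum_congr rfl fun k _ => by ring
      _ ≤ ∑ m, (t m)⁻¹ * ∑ j, ∑ i, ‖e i j * star (T m i)‖ ^ 2 := by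
          refine Finset.sum_le_sum fun m _ => mul_le_mul_of_nonneg_left
            (Finset.sum_le_sum fun j _ => ?_) (inv_nonneg.2 (ht m))
          refine le_trans (le_of_eq ?_)
            (bessel_of_mul_conjTranspose_eq_diagonal B l hUA fun i => e i j * star (T m i))
          simp only [hq, mulVec, dotProduct, mul_assoc]
      _ ≤ ∑ m, (t m)⁻¹ * t m := by
          refine Finset.sum_le_sum fun m _ => mul_le_mul_of_nonneg_left ?_ (inv_nonneg.2 (ht m))
          rw [← hTt m, Finset.sum_comm]
          refine Finset.sum_le_sum fun i _ => ?_
          simp only [norm_mul, mul_pow, norm_star, ← Finset.sum_mul]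
          exact mul_le_of_le_one_left (by positivity) (he i)
      _ ≤ ∑ _m : Fin M, (1 : ℝ) := Finset.sum_le_sum fun m _ => inv_mul_le_one
      _ = M := by simp
  obtain ⟨S, hS, hle⟩ := exists_card_eq_sum_mul_le l (fun k => (l k)⁻¹ * x k) hl
    (fun k => mul_nonneg (inv_nonneg.2 (hl k)) (hx0 k))
    (fun k => (mul_le_mul_of_nonneg_left (hxl k) (inv_nonneg.2 (hl k))).trans inv_mul_le_one)
    M hM1 hMd hxM
  have hlx : ∀ k, l k * ((l k)⁻¹ * x k) = x k := fun k => by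
    by_cases h : l k = 0
    · have := hxl k
      have := hx0 k
      simp only [h, zero_mul]
      linarith
    · field_simp
  simp only [hlx] at hle
  set D : Matrix d d ℂ := diagonal (fun k => if k ∈ S then 1 else 0) with hD
  have hDD : D * D = D := by simp [hD]
  have hDh : Dᴴ = D := by
    rw [hD, diagonal_conjTranspose]
    congr 1
    ext k
    by_cases hk : k ∈ S <;> simp [hk]
  refine ⟨Uᴴ * D * U, ?_, ?_, ?_, ?_⟩
  · simp [Matrix.IsHermitian, conjTranspose_mul, hDh, Matrix.mul_assoc]
  · calc Uᴴ * D * U * (Uᴴ * D * U) = Uᴴ * D * (U * Uᴴ) * D * U := by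
          simp only [Matrix.mul_assoc]
      _ = Uᴴ * (D * D) * U := by rw [hU1, Matrix.mul_one, Matrix.mul_assoc Uᴴ]
      _ = _ := by rw [hDD]
  · rw [trace_mul_comm, ← Matrix.mul_assoc, hU1, Matrix.one_mul]
    simp [hD, trace_diagonal, hS]
  · have h1 : (Uᴴ * D * U * (A * Aᴴ)).trace = (D * (B * Bᴴ)).trace := by
      rw [hB, conjTranspose_mul, Matrix.mul_assoc, Matrix.mul_assoc, trace_mul_comm]
      simp only [Matrix.mul_assoc]
    rw [h1, hUA, hD, diagonal_mul_diagonal, trace_diagonal, hsum]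
    refine htx.trans (hle.trans (le_of_eq ?_))
    simp [Complex.re_sum]

open scoped MatrixOrder Matrix.Norms.L2Operator in
theorem exists_eq_conjTranspose_mul_self {n : Type*} [Fintype n] [DecidableEq n]
    {A : Matrix n n ℂ} (hA : A.PosSemidef) : ∃ B : Matrix n n ℂ, A = Bᴴ * B :=
  CStarAlgebra.nonneg_iff_eq_star_mul_self.mp hA.nonneg

theorem trace_projection_mul_re_le {n : Type*} [Fintype n] [DecidableEq n] {P R : Matrix n n ℂ}
    (hP : P.IsHermitian) (hPP : P * P = P) (hR : R.PosSemidef) :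
    (P * R).trace.re ≤ R.trace.re := by
  have h1 : ((1 - P) * R).trace = ((1 - P)ᴴ * R * (1 - P)).trace := by
    rw [trace_mul_comm ((1 - P)ᴴ * R), ← Matrix.mul_assoc, conjTranspose_sub, hP.eq,
      conjTranspose_one]
    congr 2
    simp [sub_mul, mul_sub, hPP]
  have h2 := (hR.conjTranspose_mul_mul_same (1 - P)).trace_nonneg
  rw [← h1, sub_mul, Matrix.one_mul, trace_sub] at h2
  have := (Complex.le_def.1 h2).1
  simp only [Complex.zero_re, Complex.sub_re] at this
  linarith

/-- Upper bound on the ensemble average fidelity of visible compression: for a pure-state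
ensemble `{pᵢ, ψᵢ}` with average state `ρ = ∑ᵢ pᵢ ψᵢ`, arbitrary encoded states `χᵢ` on `ℂ^M`
and a CPTP decoder `𝔇` in Kraus form,
`∑ᵢ pᵢ Tr(𝔇(χᵢ) ψᵢ) ≤ max{Tr(P ρ) : P an orthogonal projection with Tr P = M}`. -/
theorem visible_fidelity_bound {d : ℕ} {I : Type} [Fintype I]
    (p : I → ℝ) (hp : ∀ i, 0 ≤ p i) (hpsum : ∑ i, p i = 1)
    (ψ : I → Matrix (Fin d) (Fin d) ℂ)
    (hψ : ∀ i, (ψ i).IsHermitian ∧ ψ i * ψ i = ψ i ∧ (ψ i).trace = 1)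
    (M : ℕ) (hM1 : 1 ≤ M) (hMd : M ≤ d)
    (χ : I → Matrix (Fin M) (Fin M) ℂ)
    (hχ : ∀ i, (χ i).PosSemidef ∧ (χ i).trace = 1)
    {J : Type} [Fintype J] (K : J → Matrix (Fin d) (Fin M) ℂ)
    (hK : ∑ j, (K j)ᴴ * K j = (1 : Matrix (Fin M) (Fin M) ℂ)) :
    ∑ i, p i * ((∑ j, K j * χ i * (K j)ᴴ) * ψ i).trace.re ≤
      sSup {r : ℝ | ∃ P : Matrix (Fin d) (Fin d) ℂ, P.IsHermitian ∧ P * P = P ∧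
        P.trace = (M : ℂ) ∧ r = (P * ∑ i, p i • ψ i).trace.re} := by
  classical
  have : Nonempty (Fin M) := ⟨⟨0, hM1⟩⟩
  set A : Matrix (Fin d) (I × Fin d) ℂ := Matrix.of fun a x => (√(p x.1) : ℂ) * ψ x.1 a x.2 with hA
  have hAA : A * Aᴴ = ∑ i, p i • ψ i := by
    ext a b
    rw [Matrix.mul_apply, Fintype.sum_prod_type, Matrix.sum_apply]
    refine Finset.sum_congr rfl fun i _ => ?_
    have h1 : (ψ i * (ψ i)ᴴ) a b = ψ i a b := by rw [(hψ i).1.eq, (hψ i).2.1]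
    have h2 : (√(p i) : ℂ) * √(p i) = p i := by
      rw [← Complex.ofReal_mul, Real.mul_self_sqrt (hp i)]
    rw [Matrix.smul_apply, ← h1, Matrix.mul_apply, Complex.real_smul, Finset.mul_sum, ← h2]
    refine Finset.sum_congr rfl fun k _ => ?_
    simp [hA]
    ring
  choose C hC using fun i => exists_eq_conjTranspose_mul_self (hχ i).1
  have hC1 : ∀ i, ∑ c, ∑ a, ‖(C i)ᴴ a c‖ ^ 2 = 1 := fun i => by
    have h := congrArg Complex.re (hχ i).2
    rw [hC i] at h
    nth_rw 2 [← conjTranspose_conjTranspose (C i)] at h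
    simp only [trace, diag_apply, mul_conjTranspose_apply_self, Complex.re_sum,
      Complex.ofReal_re, Complex.one_re] at h
    rw [Finset.sum_comm, h]
  choose e he1 he2 using fun x : I × Fin d => exists_combination_ge
    (fun j => (K j)ᴴ *ᵥ fun a => ψ x.1 a x.2) (C x.1)ᴴ (hC1 x.1)
  set L : Matrix (Fin M) (J × Fin d) ℂ := Matrix.of fun m x => star (K x.1 x.2 m) with hLdef
  have hL : L * Lᴴ = 1 := by
    rw [← hK]
    ext m n
    rw [Matrix.mul_apply, Fintype.sum_prod_type, Matrix.sum_apply]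
    simp [hLdef, Matrix.mul_apply]
  obtain ⟨P, hP, hPP, hPt, hle⟩ := exists_projection_ge_compression A e he1 hM1 (by simpa using hMd)
    L hL
  rw [hAA] at hle
  have hρ : (∑ i, p i • ψ i).PosSemidef := hAA ▸ posSemidef_self_mul_conjTranspose A
  refine le_trans ?_ (le_csSup ⟨(∑ i, p i • ψ i).trace.re, ?_⟩ ⟨P, hP, hPP, hPt, rfl⟩)
  swap
  · rintro r ⟨Q, hQ, hQQ, -, rfl⟩
    exact trace_projection_mul_re_le hQ hQQ hρ
  refine le_trans ?_ hle
  rw [Finset.sum_comm, Fintype.sum_prod_type]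
  refine Finset.sum_le_sum fun i _ => ?_
  have hF : ((∑ j, K j * χ i * (K j)ᴴ) * ψ i).trace.re = ∑ k, ∑ c, ∑ j,
      ‖(((C i)ᴴ)ᴴ *ᵥ ((K j)ᴴ *ᵥ fun a => ψ i a k)) c‖ ^ 2 := by
    have h1 : ∀ j, (K j * χ i * (K j)ᴴ * ψ i).trace
        = ((C i * (K j)ᴴ * ψ i) * (C i * (K j)ᴴ * ψ i)ᴴ).trace := fun j => by
      rw [conjTranspose_mul, conjTranspose_mul, conjTranspose_conjTranspose, (hψ i).1.eq]
      calc _ = (K j * ((C i)ᴴ * C i) * (K j)ᴴ * (ψ i * ψ i)).trace := by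
            rw [(hψ i).2.1, ← hC i]
        _ = ((K j * (C i)ᴴ) * (C i * (K j)ᴴ * ψ i * ψ i)).trace := by
            simp only [Matrix.mul_assoc]
        _ = _ := by
            rw [trace_mul_comm]
            simp only [Matrix.mul_assoc]
    rw [Finset.sum_mul, trace_sum, Complex.re_sum]
    simp only [h1]
    simp only [trace, diag_apply, mul_conjTranspose_apply_self, Complex.re_sum,
      Complex.ofReal_re]
    have h2 : ∀ j c k, (((C i)ᴴ)ᴴ *ᵥ ((K j)ᴴ *ᵥ fun a => ψ i a k)) c
        = (C i * (K j)ᴴ * ψ i) c k := fun j c k => by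
      rw [conjTranspose_conjTranspose, mulVec_mulVec]
      rfl
    simp only [h2]
    rw [Finset.sum_comm]
    conv_rhs => rw [Finset.sum_comm]
    exact Finset.sum_congr rfl fun c _ => Finset.sum_comm
  rw [hF, Finset.mul_sum]
  refine Finset.sum_le_sum fun k _ => ?_
  refine (mul_le_mul_of_nonneg_left (he2 (i, k)) (hp i)).trans (le_of_eq ?_)
  rw [Finset.mul_sum]
  refine Finset.sum_congr rfl fun m _ => ?_
  have h3 : (L * Matrix.of fun (x : J × Fin d) y => e y x.1 * A x.2 y) m (i, k)
      = (√(p i) : ℂ) * ∑ j, e (i, k) j * ((K j)ᴴ *ᵥ fun a => ψ i a k) m := by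
    rw [Matrix.mul_apply, Fintype.sum_prod_type, Finset.mul_sum]
    refine Finset.sum_congr rfl fun j _ => ?_
    simp only [mulVec, dotProduct, Finset.mul_sum]
    refine Finset.sum_congr rfl fun a _ => ?_
    simp [hLdef, hA]
    ring
  rw [h3, norm_mul, mul_pow, Complex.norm_real, Real.norm_eq_abs, sq_abs, Real.sq_sqrt (hp i)]
end
end
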